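/- arXiv:1708.06377 — 3 statements merged into one kernel-verified Lean document; each statement's English description precedes it below -/
import Mathlib

section
/- Let p be a symmetric probability kernel on ℤ^d (p(−x) = p(x) for all x) with continuous-time transition kernel p_t. Then the function t ↦ p_t(0) is nonincreasing on [0,∞): for all 0 ≤ u ≤ v, p_v(0) ≤ p_u(0). -/
noncomputable def convPow {G : Type*} [AddCommGroup G] [DecidableEq G] (p : G → ℝ) : ℕ → G → ℝ
  | 0 => fun x => if x = 0 then (1 : ℝ) else 0
  | n + 1 => fun x => ∑' y, convPow p n y * p (x - y)

noncomputable def ctKernel {G : Type*} [AddCommGroup G] [DecidableEq G] (p : G → ℝ) (t : ℝ)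
    (x : G) : ℝ :=
  Real.exp (-t) * ∑' n : ℕ, t ^ n / (Nat.factorial n : ℝ) * convPow p n x

/-- The Fourier transform turns convolution powers of a nonnegative summable kernel into powers. -/
lemma convPow_summable_and_hasSum_mul_char {G : Type*} [AddCommGroup G] [DecidableEq G]
    {p : G → ℝ} (hp : ∀ x, 0 ≤ p x) (hs : Summable p) (n : ℕ) :
    (∀ x, 0 ≤ convPow p n x) ∧ Summable (convPow p n) ∧
      ∀ χ : AddChar G ℂ, (∀ x, ‖χ x‖ = 1) →
        HasSum (fun x => (convPow p n x : ℂ) * χ x) ((∑' x, (p x : ℂ) * χ x) ^ n) := by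
  induction n with
  | zero =>
    refine ⟨fun x => ?_, ?_, fun χ _ => ?_⟩
    · simp only [convPow]
      positivity
    · exact summable_of_ne_finset_zero (s := {0}) (by simp +contextual [convPow])
    · convert hasSum_single (0 : G) ?_ using 1
      · simp [convPow]
      · simp +contextual [convPow]
  | succ n ih =>
    obtain ⟨hn, hsn, hχ⟩ := ih
    let e : G × G ≃ G × G :=
      { toFun := fun z => (z.2, z.1 - z.2)
        invFun := fun z => (z.1 + z.2, z.1)
        left_inv := fun z => by simp
        right_inv := fun z => by simp }
    have hprod : Summable fun z : G × G => convPow p n z.2 * p (z.1 - z.2) :=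
      e.summable_iff.2 (hsn.mul_of_nonneg hs hn hp)
    refine ⟨fun x => tsum_nonneg fun y => mul_nonneg (hn y) (hp _), hprod.prod, fun χ hχ1 => ?_⟩
    have norm_summable {f : G → ℝ} (hf : ∀ x, 0 ≤ f x) (h : Summable f) :
        Summable fun x => ‖(f x : ℂ) * χ x‖ := by
      simpa [abs_of_nonneg (hf _), hχ1] using h
    have hp' : HasSum (fun x => (p x : ℂ) * χ x) (∑' x, (p x : ℂ) * χ x) :=
      (norm_summable hp hs).of_norm.hasSum
    have hsmul := summable_mul_of_summable_norm (norm_summable hn hsn) (norm_summable hp hs)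
    have hmul := (hχ χ hχ1).mul hp' hsmul
    rw [pow_succ]
    refine HasSum.prod_fiberwise (e.hasSum_iff.2 hmul) fun x => ?_
    have hx := (Complex.hasSum_ofReal.2 (hprod.prod_factor x).hasSum).mul_right (χ x)
    refine hx.congr_fun ?_
    intro y
    have : χ x = χ y * χ (x - y) := by rw [← AddChar.map_add_eq_mul]; simp
    simp only [Function.comp_apply, this, e, Equiv.coe_fn_mk]
    push_cast
    ring

open MeasureTheory in
/-- The integral of a monomial over the torus is `1` for the trivial monomial and `0` otherwise. -/
lemma integral_mFourier_pi_haar {ι : Type*} [Fintype ι] [DecidableEq ι] (x : ι → ℤ) :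
    ∫ θ, UnitAddTorus.mFourier x θ ∂(Measure.pi fun _ : ι => AddCircle.haarAddCircle (T := 1)) =
      if x = 0 then 1 else 0 := by
  have h (k : ℤ) : ∫ s, fourier k s ∂(AddCircle.haarAddCircle (T := 1)) =
      if k = 0 then 1 else 0 := by
    split_ifs with hk
    · simp [hk]
    · exact integral_eq_zero_of_add_right_eq_neg (fourier_add_half_inv_index hk zero_lt_one)
  simp only [UnitAddTorus.mFourier, ContinuousMap.coe_mk]
  rw [integral_fintype_prod_eq_prod (fun (i : ι) (s : UnitAddCircle) => (fourier (x i) s : ℂ))]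
  simp only [h, Finset.prod_ite_zero, Finset.prod_const_one, funext_iff, Finset.mem_univ,
    true_imp_iff, Pi.zero_apply]

/-- The character `x ↦ exp (2πi x·θ)` of `ℤ^d`. -/
noncomputable def torusChar {ι : Type*} [Fintype ι] (θ : UnitAddTorus ι) :
    AddChar (ι → ℤ) ℂ where
  toFun x := UnitAddTorus.mFourier x θ
  map_zero_eq_one' := by simp [UnitAddTorus.mFourier_zero]
  map_add_eq_mul' x y := UnitAddTorus.mFourier_add

lemma torusChar_apply {ι : Type*} [Fintype ι] (θ : UnitAddTorus ι) (x : ι → ℤ) :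
    torusChar θ x = UnitAddTorus.mFourier x θ := rfl

lemma norm_torusChar {ι : Type*} [Fintype ι] (θ : UnitAddTorus ι) (x : ι → ℤ) :
    ‖torusChar θ x‖ = 1 := by
  simp only [torusChar_apply, UnitAddTorus.mFourier, ContinuousMap.coe_mk, norm_prod]
  exact Finset.prod_eq_one fun i _ => Circle.norm_coe _

open MeasureTheory in
/-- For a symmetric kernel, `p_t(0)` is a mixture of the functions `t ↦ exp (-t (1 - φ))` with
`φ ≤ 1`. -/
lemma exists_ctKernel_zero_eq_integral {ι : Type*} [Fintype ι] [DecidableEq ι]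
    {p : (ι → ℤ) → ℝ} (hp : ∀ x, 0 ≤ p x) (hp1 : HasSum p 1) (hsymm : ∀ x, p (-x) = p x) :
    ∃ φ : UnitAddTorus ι → ℝ, Continuous φ ∧ (∀ θ, |φ θ| ≤ 1) ∧ ∀ t : ℝ,
      ctKernel p t 0 = ∫ θ, Real.exp (-t * (1 - φ θ))
        ∂(Measure.pi fun _ : ι => AddCircle.haarAddCircle (T := 1)) := by
  set μ : Measure (UnitAddTorus ι) := Measure.pi fun _ : ι => AddCircle.haarAddCircle (T := 1)
  have hconv := convPow_summable_and_hasSum_mul_char hp hp1.summable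
  let Φ : UnitAddTorus ι → ℂ := fun θ => ∑' x, (p x : ℂ) * torusChar θ x
  have hnorm (θ) : ‖Φ θ‖ ≤ 1 :=
    tsum_of_norm_bounded hp1 fun x => by simp [abs_of_nonneg (hp x), norm_torusChar]
  have hcont : Continuous Φ := by
    refine continuous_tsum (fun x => ?_) hp1.summable
      fun x θ => by simp [abs_of_nonneg (hp x), norm_torusChar]
    simp only [torusChar_apply]
    fun_prop
  have hreal (θ) : ((Φ θ).re : ℂ) = Φ θ := by
    rw [← Complex.conj_eq_iff_re, Complex.conj_tsum, ← (Equiv.neg _).tsum_eq]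
    refine tsum_congr fun x => ?_
    simp [hsymm, torusChar_apply, UnitAddTorus.mFourier_neg]
  have hφ : Continuous fun θ => (Φ θ).re := Complex.continuous_re.comp hcont
  have hφ1 (θ) : |(Φ θ).re| ≤ 1 := (Complex.abs_re_le_norm _).trans (hnorm θ)
  have hint {f : UnitAddTorus ι → ℝ} (hf : Continuous f) : Integrable f μ :=
    hf.integrable_of_hasCompactSupport (HasCompactSupport.of_compactSpace f)
  have hmoment (n : ℕ) : convPow p n 0 = ∫ θ, (Φ θ).re ^ n ∂μ := by
    obtain ⟨hn, hsn, hχ⟩ := hconv n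
    have key := hasSum_integral_of_summable_integral_norm (μ := μ)
      (F := fun (x : ι → ℤ) θ => (convPow p n x : ℂ) * torusChar θ x)
      (fun x => by
        simp only [torusChar_apply]
        exact (Continuous.integrable_of_hasCompactSupport (by fun_prop)
          (HasCompactSupport.of_compactSpace _)))
      (by simpa [abs_of_nonneg (hn _), norm_torusChar, μ] using hsn)
    simp only [(hχ _ (norm_torusChar _)).tsum_eq, integral_const_mul] at key
    simp only [torusChar_apply, integral_mFourier_pi_haar, μ] at key
    have h0 := key.unique (hasSum_single (0 : ι → ℤ) (by simp +contextual))
    simp only [if_true, mul_one] at h0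
    apply Complex.ofReal_injective
    rw [← h0, ← integral_complex_ofReal]
    refine integral_congr_ae (.of_forall fun θ => ?_)
    simp only [Complex.ofReal_pow, hreal]
    rfl
  refine ⟨fun θ => (Φ θ).re, hφ, hφ1, fun t => ?_⟩
  have key := hasSum_integral_of_summable_integral_norm (μ := μ)
    (F := fun (n : ℕ) θ => t ^ n / (n.factorial : ℝ) * (Φ θ).re ^ n)
    (fun n => hint (by fun_prop))
    (by
      refine Summable.of_nonneg_of_le (fun n => integral_nonneg fun θ => norm_nonneg _)
        (fun n => ?_) (Real.summable_pow_div_factorial |t|)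
      have : ∫ θ, |t| ^ n / (n.factorial : ℝ) ∂μ = |t| ^ n / (n.factorial : ℝ) := by simp [μ]
      rw [← this]
      refine integral_mono (hint (by fun_prop)) (hint (by fun_prop)) fun θ => ?_
      simp only [norm_mul, norm_div, norm_pow, Real.norm_eq_abs, Nat.abs_cast]
      exact mul_le_of_le_one_right (by positivity) (pow_le_one₀ (abs_nonneg _) (hφ1 θ)))
  simp only [integral_const_mul, ← hmoment] at key
  rw [ctKernel, key.tsum_eq, ← integral_const_mul]
  refine integral_congr_ae (.of_forall fun θ => ?_)
  have hexp := NormedSpace.expSeries_div_hasSum_exp (t * (Φ θ).re)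
  rw [← Real.exp_eq_exp_ℝ] at hexp
  have : ∑' n : ℕ, t ^ n / (n.factorial : ℝ) * (Φ θ).re ^ n = Real.exp (t * (Φ θ).re) := by
    rw [← hexp.tsum_eq]
    exact tsum_congr fun n => by rw [mul_pow]; ring
  simp only [this, ← Real.exp_add]
  ring_nf

/-- for a symmetric kernel, `t ↦ p_t(0)` is nonincreasing on `[0,∞)`. -/
theorem stmt_8 (d : ℕ) (hd : 1 ≤ d)
    (p : (Fin d → ℤ) → ℝ) (hp : ∀ x, 0 ≤ p x) (hp1 : ∑' x, p x = 1)
    (hsymm : ∀ x, p (-x) = p x) :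
    ∀ u v : ℝ, 0 ≤ u → u ≤ v → ctKernel p v 0 ≤ ctKernel p u 0 := by
  intro u v _ huv
  have hs : Summable p := by
    by_contra h
    simp [tsum_eq_zero_of_not_summable h] at hp1
  obtain ⟨φ, hφ, hφ1, h⟩ := exists_ctKernel_zero_eq_integral hp (hp1 ▸ hs.hasSum) hsymm
  have hint {f : UnitAddTorus (Fin d) → ℝ} (hf : Continuous f) : MeasureTheory.Integrable f
      (MeasureTheory.Measure.pi fun _ => AddCircle.haarAddCircle (T := 1)) :=
    hf.integrable_of_hasCompactSupport (HasCompactSupport.of_compactSpace f)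
  rw [h, h]
  refine MeasureTheory.integral_mono (hint (by fun_prop)) (hint (by fun_prop)) fun θ => ?_
  have := (abs_le.1 (hφ1 θ)).2
  exact Real.exp_le_exp.2 (by nlinarith)
end

section
/- Let p be a probability kernel on ℤ^d, let p̂(x) := (p(x)+p(−x))/2 be its symmetrized kernel with continuous-time transition kernel p̂_t, and let μ be the probability kernel on ℤ^d × ℤ^d given by μ(u,w) := (1/3)·(p(u)·1_{w=0} + p(w)·1_{u=0} + p(−u)·1_{u=w}). Let P⁽²⁾_t denote the continuous-time transition kernel of μ run at rate 3, i.e. P⁽²⁾_t := μ_{3t} where μ_s is the rate-1 continuous-time kernel of μ. Then for every t ≥ 0, ∑_{z∈ℤ^d} P⁽²⁾_t(z,z) = p̂_{2t}(0). -/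
theorem summable_convolution {G : Type*} [AddCommGroup G] {f g : G → ℝ}
    (hf : Summable f) (hf0 : ∀ x, 0 ≤ f x) (hg : Summable g) (hg0 : ∀ x, 0 ≤ g x) :
    Summable fun q : G × G => f q.2 * g (q.1 - q.2) := by
  have hinj : Function.Injective fun q : G × G => (q.2, q.1 - q.2) := by
    rintro ⟨a, b⟩ ⟨c, d⟩ h
    simp only [Prod.mk.injEq] at h
    obtain ⟨rfl, h⟩ := h
    simpa using h
  exact (hf.mul_of_nonneg hg hf0 hg0).comp_injective hinj

section ConvPow

variable {G : Type*} [AddCommGroup G] [DecidableEq G]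

theorem convPow_zero_apply (p : G → ℝ) (x : G) :
    convPow p 0 x = if x = 0 then (1 : ℝ) else 0 := rfl

theorem convPow_succ_apply (p : G → ℝ) (n : ℕ) (x : G) :
    convPow p (n + 1) x = ∑' y, convPow p n y * p (x - y) := rfl

theorem convPow_nonneg {p : G → ℝ} (hp : ∀ x, 0 ≤ p x) (n : ℕ) (x : G) :
    0 ≤ convPow p n x := by
  induction n generalizing x with
  | zero => rw [convPow_zero_apply]; positivity
  | succ n ih =>
    rw [convPow_succ_apply]
    exact tsum_nonneg fun y => mul_nonneg (ih y) (hp _)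

theorem hasSum_convPow {p : G → ℝ} (hp : ∀ x, 0 ≤ p x) (hp1 : HasSum p 1) (n : ℕ) :
    HasSum (convPow p n) 1 := by
  induction n with
  | zero => exact hasSum_ite_eq 0 (1 : ℝ)
  | succ n ih =>
    have hs := summable_convolution ih.summable (convPow_nonneg hp n) hp1.summable hp
    have hsum : Summable (convPow p (n + 1)) := hs.prod
    have hshift (y : G) : ∑' x, p (x - y) = 1 := by
      rw [← hp1.tsum_eq]
      exact (Equiv.subRight y).tsum_eq p
    have htsum : ∑' x, convPow p (n + 1) x = 1 := by
      simp only [convPow_succ_apply]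
      rw [← Summable.tsum_comm (f := fun x y => convPow p n y * p (x - y)) hs]
      simp only [tsum_mul_left, hshift, mul_one, ih.tsum_eq]
    exact htsum ▸ hsum.hasSum

theorem convPow_le_one {p : G → ℝ} (hp : ∀ x, 0 ≤ p x) (hp1 : HasSum p 1) (n : ℕ) (x : G) :
    convPow p n x ≤ 1 :=
  le_hasSum (hasSum_convPow hp hp1 n) x fun y _ => convPow_nonneg hp n y

theorem summable_convPow_mul {p : G → ℝ} (hp : ∀ x, 0 ≤ p x) (hp1 : HasSum p 1) (n : ℕ) (x : G) :
    Summable fun y => convPow p n y * p (x - y) :=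
  (summable_convolution (hasSum_convPow hp hp1 n).summable (convPow_nonneg hp n)
    hp1.summable hp).prod_factor x

/-- Convolution powers of a lazy version of a kernel expand binomially. -/
theorem convPow_lazy {p q : G → ℝ} (hp : ∀ x, 0 ≤ p x) (hp1 : HasSum p 1) {α β : ℝ}
    (hq : ∀ x, q x = α * p x + β * if x = 0 then 1 else 0) (n : ℕ) (x : G) :
    convPow q n x = ∑ ij ∈ Finset.HasAntidiagonal.antidiagonal n,
      (n.choose ij.1 : ℝ) * (α ^ ij.1 * β ^ ij.2 * convPow p ij.1 x) := by
  induction n generalizing x with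
  | zero => simp [convPow_zero_apply]
  | succ n ih =>
    have hterm (y : G) : convPow q n y * q (x - y) =
        (∑ ij ∈ Finset.HasAntidiagonal.antidiagonal n, (n.choose ij.1 : ℝ) * (α ^ (ij.1 + 1) * β ^ ij.2) *
          (convPow p ij.1 y * p (x - y))) +
        if y = x then β * convPow q n x else 0 := by
      rw [hq, mul_add]
      congr 1
      · rw [ih, Finset.sum_mul]
        exact Finset.sum_congr rfl fun _ _ => by ring
      · by_cases h : y = x
        · subst h; simp [mul_comm]
        · simp [h, sub_eq_zero, Ne.symm h]
    have hs : HasSum (fun y => convPow q n y * q (x - y))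
        ((∑ ij ∈ Finset.HasAntidiagonal.antidiagonal n, (n.choose ij.1 : ℝ) * (α ^ (ij.1 + 1) * β ^ ij.2) *
          convPow p (ij.1 + 1) x) + β * convPow q n x) := by
      simp only [hterm]
      exact (hasSum_sum fun ij _ =>
        (summable_convPow_mul hp hp1 ij.1 x).hasSum.mul_left _).add (hasSum_ite_eq x _)
    rw [convPow_succ_apply, hs.tsum_eq,
      Finset.sum_antidiagonal_choose_succ_mul
        (fun i j => α ^ i * β ^ j * convPow p i x) n, ih, Finset.mul_sum, add_comm]
    congr 1
    · exact Finset.sum_congr rfl fun _ _ => by ring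
    · refine Finset.sum_congr rfl fun ij hij => ?_
      rw [Nat.choose_symm_of_eq_add (Finset.HasAntidiagonal.mem_antidiagonal.1 hij).symm]
      ring

theorem summable_pow_div_factorial_mul_convPow {p : G → ℝ} (hp : ∀ x, 0 ≤ p x)
    (hp1 : HasSum p 1) (t : ℝ) (x : G) :
    Summable fun n : ℕ => ‖t ^ n / (Nat.factorial n : ℝ) * convPow p n x‖ := by
  refine Summable.of_nonneg_of_le (fun _ => norm_nonneg _) (fun n => ?_)
    (Real.summable_pow_div_factorial t).norm
  rw [norm_mul, Real.norm_of_nonneg (convPow_nonneg hp n x)]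
  exact mul_le_of_le_one_right (norm_nonneg _) (convPow_le_one hp hp1 n x)

/-- Laziness of the jump kernel amounts to a slowdown of the continuous-time walk. -/
theorem ctKernel_lazy {p q : G → ℝ} (hp : ∀ x, 0 ≤ p x) (hp1 : HasSum p 1) {α β : ℝ}
    (hαβ : α + β = 1) (hq : ∀ x, q x = α * p x + β * if x = 0 then 1 else 0) (t : ℝ) (x : G) :
    ctKernel q t x = ctKernel p (α * t) x := by
  have hcauchy := tsum_mul_tsum_eq_tsum_sum_antidiagonal_of_summable_norm
    (summable_pow_div_factorial_mul_convPow hp hp1 (α * t) x)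
    (Real.summable_pow_div_factorial (β * t)).norm
  have hexp : ∑' n : ℕ, (β * t) ^ n / (Nat.factorial n : ℝ) = Real.exp (β * t) := by
    rw [Real.exp_eq_exp_ℝ, NormedSpace.exp_eq_tsum_div]
  have hseries : ∑' n : ℕ, t ^ n / (Nat.factorial n : ℝ) * convPow q n x =
      (∑' n : ℕ, (α * t) ^ n / (Nat.factorial n : ℝ) * convPow p n x) * Real.exp (β * t) := by
    rw [← hexp, hcauchy]
    refine tsum_congr fun n => ?_
    rw [convPow_lazy hp hp1 hq, Finset.mul_sum]
    refine Finset.sum_congr rfl fun ij hij => ?_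
    obtain rfl := Finset.HasAntidiagonal.mem_antidiagonal.1 hij
    rw [Nat.cast_add_choose]
    have h₁ : ((ij.1 + ij.2).factorial : ℝ) ≠ 0 := by positivity
    have h₂ : (ij.1.factorial : ℝ) ≠ 0 := by positivity
    have h₃ : (ij.2.factorial : ℝ) ≠ 0 := by positivity
    field_simp
    ring
  have hrate : -(α * t) = -t + β * t := by linear_combination -t * hαβ
  rw [ctKernel, ctKernel, hseries, hrate, Real.exp_add]
  ring

/-- The image of a convolution power under `(u, w) ↦ u - w` is the convolution power of the
image. -/
theorem tsum_convPow_add_fst {μ : G × G → ℝ} {ν : G → ℝ} (hμ : ∀ v, 0 ≤ μ v) (hμ1 : HasSum μ 1)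
    (hν : ∀ a, HasSum (fun z => μ (z + a, z)) (ν a)) (n : ℕ) (a : G) :
    ∑' z, convPow μ n (z + a, z) = convPow ν n a := by
  induction n generalizing a with
  | zero =>
    simp only [convPow_zero_apply]
    rw [tsum_eq_single 0 fun z hz => by simp [hz]]
    simp
  | succ n ih =>
    have hinj : Function.Injective fun q : G × (G × G) => (((q.1 + a, q.1) : G × G), q.2) := by
      rintro ⟨z, v⟩ ⟨z', v'⟩ h
      simp_all
    have hs : Summable fun q : G × (G × G) => convPow μ n q.2 * μ ((q.1 + a, q.1) - q.2) :=
      (summable_convolution (hasSum_convPow hμ hμ1 n).summable (convPow_nonneg hμ n)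
        hμ1.summable hμ).comp_injective hinj
    have hinner (v : G × G) :
        ∑' z, convPow μ n v * μ ((z + a, z) - v) = convPow μ n v * ν (a - (v.1 - v.2)) := by
      rw [tsum_mul_left, ← (hν _).tsum_eq,
          ← (Equiv.subRight v.2).tsum_eq fun z => μ (z + (a - (v.1 - v.2)), z)]
      congr 1
      refine tsum_congr fun z => congrArg μ (Prod.ext ?_ ?_)
      · simp only [Prod.fst_sub, Equiv.subRight_apply]
        abel
      · simp
    have hsv : Summable fun v : G × G => convPow μ n v * ν (a - (v.1 - v.2)) := by
      simp only [← hinner]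
      exact hs.prod_symm.prod
    let e : G × G ≃ G × G :=
      { toFun := fun q => (q.2 + q.1, q.2)
        invFun := fun v => (v.1 - v.2, v.2)
        left_inv := fun q => by simp
        right_inv := fun v => by simp }
    have hse : Summable fun q : G × G => convPow μ n (q.2 + q.1, q.2) * ν (a - q.1) := by
      simpa [e, Function.comp_def] using e.summable_iff.2 hsv
    simp only [convPow_succ_apply]
    rw [← Summable.tsum_comm (f := fun z v => convPow μ n v * μ ((z + a, z) - v)) hs,
      tsum_congr hinner, ← e.tsum_eq]
    simp only [e, Equiv.coe_fn_mk, add_sub_cancel_left]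
    rw [hse.tsum_prod]
    exact tsum_congr fun b => by rw [← ih, ← tsum_mul_right]

theorem hasSum_ctKernel_diag {μ : G × G → ℝ} {ν : G → ℝ} (hμ : ∀ v, 0 ≤ μ v) (hμ1 : HasSum μ 1)
    (hν : ∀ a, HasSum (fun z => μ (z + a, z)) (ν a)) (t : ℝ) :
    HasSum (fun z => ctKernel μ t (z, z)) (ctKernel ν t 0) := by
  have hinj : Function.Injective fun z : G => (z, z) := fun _ _ h => congrArg Prod.fst h
  have hdiag (n : ℕ) : Summable fun z => convPow μ n (z, z) :=
    (hasSum_convPow hμ hμ1 n).summable.comp_injective hinj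
  have hdiag_eq (n : ℕ) : ∑' z, convPow μ n (z, z) = convPow ν n 0 := by
    simpa using tsum_convPow_add_fst hμ hμ1 hν n 0
  have hdiag_le (n : ℕ) : ∑' z, convPow μ n (z, z) ≤ 1 := by
    rw [← (hasSum_convPow hμ hμ1 n).tsum_eq]
    exact Summable.tsum_le_tsum_of_inj (fun z : G => (z, z)) hinj
      (fun v _ => convPow_nonneg hμ n v) (fun _ => le_rfl) (hdiag n)
      (hasSum_convPow hμ hμ1 n).summable
  have hs : Summable fun q : ℕ × G =>
      t ^ q.1 / (Nat.factorial q.1 : ℝ) * convPow μ q.1 (q.2, q.2) := by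
    refine Summable.of_norm ?_
    rw [summable_prod_of_nonneg fun _ => norm_nonneg _]
    refine ⟨fun n => ?_, ?_⟩
    · exact ((hdiag n).mul_left (t ^ n / (Nat.factorial n : ℝ))).norm
    · refine Summable.of_nonneg_of_le (fun _ => tsum_nonneg fun _ => norm_nonneg _) (fun n => ?_)
        (Real.summable_pow_div_factorial t).norm
      simp only [norm_mul, Real.norm_of_nonneg (convPow_nonneg hμ n _)]
      rw [tsum_mul_left]
      exact mul_le_of_le_one_right (norm_nonneg _) (hdiag_le n)
  have hsum : Summable fun z => ctKernel μ t (z, z) := hs.prod_symm.prod.mul_left _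
  have htsum : ∑' z, ctKernel μ t (z, z) = ctKernel ν t 0 := by
    simp only [ctKernel]
    rw [tsum_mul_left, Summable.tsum_comm
      (f := fun n z => t ^ n / (Nat.factorial n : ℝ) * convPow μ n (z, z)) hs]
    simp only [tsum_mul_left, hdiag_eq]
  exact htsum ▸ hsum.hasSum

end ConvPow

/-- with `μ(u,w) = (1/3)(p(u)1_{w=0} + p(w)1_{u=0} + p(−u)1_{u=w})` and
`P⁽²⁾_t = μ_{3t}`, one has `∑_z P⁽²⁾_t(z,z) = p̂_{2t}(0)`. -/
theorem stmt_10 (d : ℕ) (hd : 1 ≤ d)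
    (p : (Fin d → ℤ) → ℝ) (hp : ∀ x, 0 ≤ p x) (hp1 : ∑' x, p x = 1)
    (phat : (Fin d → ℤ) → ℝ) (hphat : ∀ x, phat x = (p x + p (-x)) / 2)
    (μ : (Fin d → ℤ) × (Fin d → ℤ) → ℝ)
    (hμ : ∀ u w : Fin d → ℤ, μ (u, w) = (1 / 3 : ℝ) *
      (p u * (if w = 0 then 1 else 0) + p w * (if u = 0 then 1 else 0) +
        p (-u) * (if u = w then 1 else 0))) :
    ∀ t : ℝ, 0 ≤ t →
      Summable (fun z : Fin d → ℤ => ctKernel μ (3 * t) (z, z)) ∧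
      ∑' z : Fin d → ℤ, ctKernel μ (3 * t) (z, z) = ctKernel phat (2 * t) 0 := by
  intro t _
  have hp_sum : HasSum p 1 := by
    have hs : Summable p := by
      by_contra h
      simp [tsum_eq_zero_of_not_summable h] at hp1
    exact hp1 ▸ hs.hasSum
  have hp_neg : HasSum (fun x => p (-x)) 1 := (Equiv.neg _).hasSum_iff.2 hp_sum
  have hphat_nonneg (x) : 0 ≤ phat x := by
    rw [hphat]
    linarith [hp x, hp (-x)]
  have hphat_sum : HasSum phat 1 := by
    have h := (hp_sum.add hp_neg).div_const 2
    norm_num at h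
    exact h.congr_fun hphat
  have hμ_nonneg (v) : 0 ≤ μ v := by
    obtain ⟨u, w⟩ := v
    have := hp u
    have := hp w
    have := hp (-u)
    rw [hμ]
    positivity
  have hμ_sum : HasSum μ 1 := by
    have h₁ : HasSum (fun v : (Fin d → ℤ) × (Fin d → ℤ) =>
        p v.1 * (if v.2 = 0 then 1 else 0)) 1 := by
      have hinj : Function.Injective fun u : Fin d → ℤ => (u, (0 : Fin d → ℤ)) :=
        fun _ _ h => congrArg Prod.fst h
      rw [← hinj.hasSum_iff]
      · simpa [Function.comp_def] using hp_sum
      · rintro ⟨u, w⟩ h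
        have : w ≠ 0 := by rintro rfl; exact h ⟨u, rfl⟩
        simp [this]
    have h₂ : HasSum (fun v : (Fin d → ℤ) × (Fin d → ℤ) =>
        p v.2 * (if v.1 = 0 then 1 else 0)) 1 := by
      rw [← (Equiv.prodComm (Fin d → ℤ) (Fin d → ℤ)).hasSum_iff]
      exact h₁
    have h₃ : HasSum (fun v : (Fin d → ℤ) × (Fin d → ℤ) =>
        p (-v.1) * (if v.1 = v.2 then 1 else 0)) 1 := by
      have hinj : Function.Injective fun u : Fin d → ℤ => (u, u) :=
        fun _ _ h => congrArg Prod.fst h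
      rw [← hinj.hasSum_iff]
      · simpa [Function.comp_def] using hp_neg
      · rintro ⟨u, w⟩ h
        have : u ≠ w := by rintro rfl; exact h ⟨u, rfl⟩
        simp [this]
    have h := ((h₁.add h₂).add h₃).mul_left (1 / 3 : ℝ)
    norm_num only at h
    refine h.congr_fun ?_
    rintro ⟨u, w⟩
    rw [hμ]
  have hμ_diff (a) : HasSum (fun z => μ (z + a, z))
      (2 / 3 * phat a + 1 / 3 * if a = 0 then 1 else 0) := by
    have h₁ : HasSum (fun z => p (z + a) * (if z = 0 then 1 else 0)) (p a) := by
      refine (hasSum_ite_eq 0 (p a)).congr_fun fun z => ?_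
      by_cases hz : z = 0 <;> simp [hz]
    have h₂ : HasSum (fun z => p z * (if z + a = 0 then 1 else 0)) (p (-a)) := by
      refine (hasSum_ite_eq (-a) (p (-a))).congr_fun fun z => ?_
      by_cases hz : z = -a <;> simp [hz, add_eq_zero_iff_eq_neg]
    have h₃ : HasSum (fun z => p (-(z + a)) * (if z + a = z then 1 else 0))
        (if a = 0 then 1 else 0) := by
      by_cases ha : a = 0
      · simpa [ha] using hp_neg
      · simp [ha, hasSum_zero]
    have hval : (2 / 3 * phat a + 1 / 3 * if a = 0 then 1 else 0) =
        1 / 3 * (p a + p (-a) + if a = 0 then 1 else 0) := by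
      rw [hphat]
      ring
    rw [hval]
    exact (((h₁.add h₂).add h₃).mul_left (1 / 3 : ℝ)).congr_fun fun z => hμ _ _
  have h := hasSum_ctKernel_diag hμ_nonneg hμ_sum hμ_diff (3 * t)
  refine ⟨h.summable, ?_⟩
  rw [h.tsum_eq, ctKernel_lazy hphat_nonneg hphat_sum (by norm_num) fun _ => rfl]
  congr 1
  ring
end

section
/- Let p be a probability kernel on ℤ^d with continuous-time transition kernel p_t, let γ ≥ 0, T > 0 and x₀ ∈ ℤ^d. For a finitely supported η : ℤ^d → ℕ and t ∈ [0,T], set h(η,t) := ∑_{x∈ℤ^d} η(x)·p_{T−t}(x₀−x). Then for every finitely supported η and every t ∈ [0,T), the function t ↦ h(η,t) is differentiable at t and h is space-time harmonic: ∑_{x,y∈ℤ^d} η(x)·p(y−x)·(h(η^{x→y},t) − h(η,t)) + (γ/2)·∑_{x∈ℤ^d} 1_{η(x)=1}·(h(η^{+x},t) + h(η^{−x},t) − 2h(η,t)) + (∂/∂t)h(η,t) = 0, all series converging absolutely. -/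
/-- `η^{x→y}`: one particle moved from `x` to `y`. -/
noncomputable def moveTo {G : Type*} [DecidableEq G] (η : G →₀ ℕ) (x y : G) : G →₀ ℕ :=
  η - Finsupp.single x 1 + Finsupp.single y 1

/-- `η^{+x}`: one particle added at `x`. -/
noncomputable def addAt {G : Type*} [DecidableEq G] (η : G →₀ ℕ) (x : G) : G →₀ ℕ :=
  η + Finsupp.single x 1

/-- `η^{−x}`: one particle removed at `x`. -/
noncomputable def subAt {G : Type*} [DecidableEq G] (η : G →₀ ℕ) (x : G) : G →₀ ℕ :=
  η - Finsupp.single x 1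

/-- A series `∑ tⁿ/n! · aₙ` with bounded coefficients may be differentiated termwise. -/
theorem hasDerivAt_tsum_pow_div_factorial {a : ℕ → ℝ} {C : ℝ} (ha : ∀ n, |a n| ≤ C) (t : ℝ) :
    HasDerivAt (fun s : ℝ => ∑' n : ℕ, s ^ n / (n.factorial : ℝ) * a n)
      (∑' n : ℕ, t ^ n / (n.factorial : ℝ) * a (n + 1)) t := by
  have hC : 0 ≤ C := (abs_nonneg _).trans (ha 0)
  set R : ℝ := |t| + 1
  have hR : 0 ≤ R := by positivity
  have hsum (s : ℝ) : Summable fun n : ℕ => s ^ n / (n.factorial : ℝ) * a n :=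
    .of_norm_bounded ((Real.summable_pow_div_factorial |s|).mul_right C) fun n => by
      rw [norm_mul, norm_div, norm_pow, Real.norm_natCast]
      exact mul_le_mul_of_nonneg_left (ha n) (by positivity)
  have hsum' : Summable fun n : ℕ => (n : ℝ) * R ^ (n - 1) / (n.factorial : ℝ) * C := by
    rw [← summable_nat_add_iff 1]
    refine ((Real.summable_pow_div_factorial R).mul_right C).congr fun n => ?_
    rw [Nat.factorial_succ, Nat.add_sub_cancel]
    push_cast
    field_simp
  have key := hasDerivAt_tsum_of_isPreconnected (t := Metric.ball (0 : ℝ) R)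
    (g := fun (n : ℕ) (s : ℝ) => s ^ n / (n.factorial : ℝ) * a n)
    (g' := fun (n : ℕ) (s : ℝ) => (n : ℝ) * s ^ (n - 1) / (n.factorial : ℝ) * a n)
    (y₀ := 0) (y := t) hsum' Metric.isOpen_ball (convex_ball _ _).isPreconnected
    (fun n s _ => ((hasDerivAt_pow n s).div_const _).mul_const _)
    (fun n s hs => by
      have hs' : |s| ≤ R := by simpa using (Metric.mem_ball.1 hs).le
      rw [norm_mul, norm_div, norm_mul, norm_pow, Real.norm_natCast, Real.norm_natCast]
      simp only [Real.norm_eq_abs]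
      gcongr
      exact ha n)
    (by simp [R]; positivity) (hsum 0) (by simp [R])
  have hs : Summable fun n : ℕ => (n : ℝ) * t ^ (n - 1) / (n.factorial : ℝ) * a n :=
    .of_norm_bounded hsum' fun n => by
      rw [norm_mul, norm_div, norm_mul, norm_pow, Real.norm_natCast, Real.norm_natCast]
      simp only [Real.norm_eq_abs]
      gcongr
      · simp [R]
      · exact ha n
  refine key.congr_deriv ?_
  rw [hs.tsum_eq_zero_add]
  simp only [Nat.cast_zero, zero_mul, zero_div, zero_add]
  refine tsum_congr fun n => ?_
  rw [Nat.factorial_succ, Nat.add_sub_cancel]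
  push_cast
  field_simp

section Kernel

variable {G : Type*} [AddCommGroup G] [DecidableEq G] {p : G → ℝ}

theorem convPow_mem_Icc (hp : ∀ x, 0 ≤ p x) (hp1 : HasSum p 1) (n : ℕ) (x : G) :
    convPow p n x ∈ Set.Icc (0 : ℝ) 1 := by
  induction n generalizing x with
  | zero => simp only [convPow]; split_ifs <;> simp
  | succ n ih =>
    have hx : HasSum (fun y => p (x - y)) 1 := (Equiv.subLeft x).hasSum_iff.2 hp1
    have hle (y : G) : convPow p n y * p (x - y) ≤ p (x - y) :=
      mul_le_of_le_one_left (hp _) (ih y).2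
    have hnn (y : G) : 0 ≤ convPow p n y * p (x - y) := mul_nonneg (ih y).1 (hp _)
    refine ⟨tsum_nonneg hnn, ?_⟩
    rw [← hx.tsum_eq]
    exact (Summable.of_nonneg_of_le hnn hle hx.summable).tsum_le_tsum hle hx.summable

theorem abs_convPow_le (hp : ∀ x, 0 ≤ p x) (hp1 : HasSum p 1) (n : ℕ) (x : G) :
    |convPow p n x| ≤ 1 := by
  have h := convPow_mem_Icc hp hp1 n x
  rw [abs_of_nonneg h.1]
  exact h.2

theorem abs_ctKernel_le (hp : ∀ x, 0 ≤ p x) (hp1 : HasSum p 1) (t : ℝ) (x : G) :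
    |ctKernel p t x| ≤ Real.exp (-t) * ∑' n : ℕ, |t| ^ n / (n.factorial : ℝ) := by
  rw [ctKernel, abs_mul, Real.abs_exp]
  gcongr
  rw [← Real.norm_eq_abs]
  refine tsum_of_norm_bounded (Real.summable_pow_div_factorial |t|).hasSum fun n => ?_
  rw [norm_mul, norm_div, norm_pow, Real.norm_natCast]
  exact mul_le_of_le_one_right (by positivity) (abs_convPow_le hp hp1 n x)

theorem tsum_pow_div_factorial_mul_convPow_succ (hp : ∀ x, 0 ≤ p x) (hp1 : HasSum p 1)
    (t : ℝ) (x : G) :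
    ∑' n : ℕ, t ^ n / (n.factorial : ℝ) * convPow p (n + 1) x =
      ∑' y, p (x - y) * ∑' n : ℕ, t ^ n / (n.factorial : ℝ) * convPow p n y := by
  have hx : Summable fun y => p (x - y) := ((Equiv.subLeft x).hasSum_iff.2 hp1).summable
  have hs : Summable fun q : ℕ × G =>
      t ^ q.1 / (q.1.factorial : ℝ) * (convPow p q.1 q.2 * p (x - q.2)) := by
    refine .of_norm_bounded ((Real.summable_pow_div_factorial |t|).mul_of_nonneg hx
      (fun n => by positivity) fun y => hp _) fun q => ?_
    rw [norm_mul, norm_mul, norm_div, norm_pow, Real.norm_natCast, Real.norm_of_nonneg (hp _)]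
    refine mul_le_mul_of_nonneg_left ?_ (by positivity)
    exact mul_le_of_le_one_left (hp _) (abs_convPow_le hp hp1 _ _)
  simp only [convPow, ← tsum_mul_left]
  rw [← Summable.tsum_comm (f := fun n y =>
    t ^ n / (n.factorial : ℝ) * (convPow p n y * p (x - y))) hs]
  exact tsum_congr fun y => tsum_congr fun n => by ring

/-- The Kolmogorov backward equation for the continuous-time kernel. -/
theorem hasDerivAt_ctKernel (hp : ∀ x, 0 ≤ p x) (hp1 : HasSum p 1) (t : ℝ) (x : G) :
    HasDerivAt (fun s => ctKernel p s x)
      (∑' y, p (x - y) * ctKernel p t y - ctKernel p t x) t := by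
  have h := (hasDerivAt_neg t).exp.mul
    (hasDerivAt_tsum_pow_div_factorial (fun n => abs_convPow_le hp hp1 n x) t)
  refine h.congr_deriv ?_
  rw [tsum_pow_div_factorial_mul_convPow_succ hp hp1]
  simp only [ctKernel, mul_left_comm (p _), tsum_mul_left]
  ring

end Kernel

section Moves

variable {G : Type*}

theorem tsum_add_configuration (η ζ : G →₀ ℕ) (f : G → ℝ) :
    ∑' x, ((η + ζ) x : ℝ) * f x = ∑' x, (η x : ℝ) * f x + ∑' x, (ζ x : ℝ) * f x := by
  have hs (ξ : G →₀ ℕ) : Summable fun x => (ξ x : ℝ) * f x :=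
    summable_of_ne_finset_zero (s := ξ.support) fun x hx => by
      simp [Finsupp.notMem_support_iff.1 hx]
  rw [← (hs η).tsum_add (hs ζ)]
  exact tsum_congr fun x => by push_cast [Finsupp.add_apply]; ring

theorem tsum_single_configuration (x : G) (f : G → ℝ) :
    ∑' z, ((Finsupp.single x 1 : G →₀ ℕ) z : ℝ) * f z = f x := by
  rw [tsum_eq_single x fun z hz => by simp [Finsupp.single_eq_of_ne hz]]
  simp

variable [DecidableEq G]

theorem tsum_subAt (η : G →₀ ℕ) {x : G} (hx : η x ≠ 0) (f : G → ℝ) :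
    ∑' z, (subAt η x z : ℝ) * f z = ∑' z, (η z : ℝ) * f z - f x := by
  have h : subAt η x + Finsupp.single x 1 = η :=
    tsub_add_cancel_of_le (Finsupp.single_le_iff.2 (Nat.one_le_iff_ne_zero.2 hx))
  conv_rhs => rw [← h]
  rw [tsum_add_configuration, tsum_single_configuration, add_sub_cancel_right]

theorem tsum_addAt (η : G →₀ ℕ) (x : G) (f : G → ℝ) :
    ∑' z, (addAt η x z : ℝ) * f z = ∑' z, (η z : ℝ) * f z + f x := by
  rw [addAt, tsum_add_configuration, tsum_single_configuration]

theorem tsum_moveTo (η : G →₀ ℕ) {x : G} (hx : η x ≠ 0) (y : G) (f : G → ℝ) :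
    ∑' z, (moveTo η x y z : ℝ) * f z = ∑' z, (η z : ℝ) * f z - f x + f y := by
  rw [← tsum_subAt η hx, ← tsum_addAt]
  rfl

end Moves

/-- The generator of the independent motion applied to `η ↦ ∑ x, η x * f x`. -/
theorem hasSum_moves {G : Type*} [AddCommGroup G] {p : G → ℝ} (hp : ∀ x, 0 ≤ p x)
    (hp1 : HasSum p 1) {f : G → ℝ} {C : ℝ} (hf : ∀ x, |f x| ≤ C) (η : G →₀ ℕ) :
    HasSum (fun q : G × G => (η q.1 : ℝ) * p (q.2 - q.1) * (f q.2 - f q.1))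
      (∑ x ∈ η.support, (η x : ℝ) * (∑' y, p (y - x) * f y - f x)) := by
  have hpx (x : G) : HasSum (fun y => p (y - x)) 1 := (Equiv.subRight x).hasSum_iff.2 hp1
  have hη : Summable fun x => (η x : ℝ) :=
    summable_of_ne_finset_zero (s := η.support) fun x hx => by
      simp [Finsupp.notMem_support_iff.1 hx]
  have hprod : Summable fun q : G × G => (η q.1 : ℝ) * p (q.2 - q.1) :=
    ((Equiv.refl G).prodShear fun x => Equiv.subRight x).summable_iff.2
      (hη.mul_of_nonneg hp1.summable (fun x => by positivity) hp)
  have hs : Summable fun q : G × G => (η q.1 : ℝ) * p (q.2 - q.1) * (f q.2 - f q.1) := by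
    refine .of_norm_bounded (hprod.mul_right (C + C)) fun q => ?_
    rw [norm_mul, Real.norm_of_nonneg (mul_nonneg (Nat.cast_nonneg _) (hp _))]
    refine mul_le_mul_of_nonneg_left ?_ (mul_nonneg (Nat.cast_nonneg _) (hp _))
    exact (abs_sub _ _).trans (add_le_add (hf _) (hf _))
  have hrow (x : G) : ∑' y, (η x : ℝ) * p (y - x) * (f y - f x) =
      (η x : ℝ) * (∑' y, p (y - x) * f y - f x) := by
    have hpf : Summable fun y => p (y - x) * f y := by
      refine .of_norm_bounded ((hpx x).summable.mul_right C) fun y => ?_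
      rw [norm_mul, Real.norm_of_nonneg (hp _)]
      exact mul_le_mul_of_nonneg_left (hf y) (hp _)
    simp only [mul_assoc, tsum_mul_left]
    simp only [mul_sub (p _)]
    rw [hpf.tsum_sub ((hpx x).summable.mul_right (f x)), tsum_mul_right, (hpx x).tsum_eq,
      one_mul]
  convert hs.hasSum using 1
  rw [hs.tsum_prod]
  simp only [hrow]
  exact (tsum_eq_sum fun x hx => by simp [Finsupp.notMem_support_iff.1 hx]).symm

/-- `h(η,t) = ∑_x η(x) p_{T−t}(x₀−x)` is differentiable in `t` and space-time
harmonic for the lonely branching random walk generator. -/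
theorem stmt_14 (d : ℕ) (hd : 1 ≤ d)
    (p : (Fin d → ℤ) → ℝ) (hp : ∀ x, 0 ≤ p x) (hp1 : ∑' x, p x = 1)
    (γ : ℝ) (hγ : 0 ≤ γ) (T : ℝ) (hT : 0 < T) (x₀ : Fin d → ℤ)
    (H : ((Fin d → ℤ) →₀ ℕ) → ℝ → ℝ)
    (hH : ∀ η s, H η s = ∑' x : Fin d → ℤ, (η x : ℝ) * ctKernel p (T - s) (x₀ - x)) :
    ∀ η : (Fin d → ℤ) →₀ ℕ, ∀ t : ℝ, 0 ≤ t → t < T →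
      (Summable fun xy : (Fin d → ℤ) × (Fin d → ℤ) =>
        (η xy.1 : ℝ) * p (xy.2 - xy.1) * (H (moveTo η xy.1 xy.2) t - H η t)) ∧
      (Summable fun x : Fin d → ℤ =>
        if η x = 1 then H (addAt η x) t + H (subAt η x) t - 2 * H η t else 0) ∧
      ∃ hd' : ℝ, HasDerivAt (fun s => H η s) hd' t ∧
        (∑' xy : (Fin d → ℤ) × (Fin d → ℤ),
            (η xy.1 : ℝ) * p (xy.2 - xy.1) * (H (moveTo η xy.1 xy.2) t - H η t))
          + (γ / 2) * (∑' x : Fin d → ℤ,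
              if η x = 1 then H (addAt η x) t + H (subAt η x) t - 2 * H η t else 0)
          + hd' = 0 := by
  intro η t _ _
  have hp1' : HasSum p 1 := by
    have hs : Summable p := by
      by_contra h
      simp [tsum_eq_zero_of_not_summable h] at hp1
    exact hp1 ▸ hs.hasSum
  set f : (Fin d → ℤ) → ℝ := fun x => ctKernel p (T - t) (x₀ - x)
  have hmove : (fun xy : (Fin d → ℤ) × (Fin d → ℤ) =>
      (η xy.1 : ℝ) * p (xy.2 - xy.1) * (H (moveTo η xy.1 xy.2) t - H η t)) =
      fun q => (η q.1 : ℝ) * p (q.2 - q.1) * (f q.2 - f q.1) := by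
    funext q
    by_cases hq : η q.1 = 0
    · simp [hq]
    · rw [hH, hH, tsum_moveTo η hq q.2 f]
      ring
  have hbranch : (fun x : Fin d → ℤ =>
      if η x = 1 then H (addAt η x) t + H (subAt η x) t - 2 * H η t else 0) = fun _ => 0 := by
    funext x
    split_ifs with hx
    · rw [hH, hH, hH, tsum_addAt η x f, tsum_subAt η (by simp [hx]) f]
      ring
    · rfl
  have hsum := hasSum_moves hp hp1' (f := f) (fun x => abs_ctKernel_le hp hp1' (T - t) (x₀ - x)) η
  rw [hmove, hbranch]
  refine ⟨hsum.summable, summable_zero,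
    -∑ x ∈ η.support, (η x : ℝ) * (∑' y, p (y - x) * f y - f x), ?_, ?_⟩
  · have hfin : (fun s => H η s) =
        fun s => ∑ x ∈ η.support, (η x : ℝ) * ctKernel p (T - s) (x₀ - x) := by
      funext s
      rw [hH]
      exact tsum_eq_sum fun x hx => by simp [Finsupp.notMem_support_iff.1 hx]
    rw [hfin, ← Finset.sum_neg_distrib]
    refine HasDerivAt.fun_sum fun x _ => ?_
    have h := ((hasDerivAt_ctKernel hp hp1' (T - t) (x₀ - x)).comp_const_sub T t).const_mul
      (η x : ℝ)
    refine h.congr_deriv ?_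
    rw [mul_neg, ← (Equiv.subLeft x₀).tsum_eq]
    simp [f]
  · rw [hsum.tsum_eq]
    simp
end
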